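/- Let G be a finite group and H ≤ G a subgroup such that the overgroup lattice O_G(H) is Boolean of rank ℓ with coatoms M₁,…,M_ℓ, and suppose O_G(H) is group-complemented, i.e. K·K^∁ = K^∁·K (as subsets of G) for every K ∈ O_G(H). Then the dual Euler totient satisfies φ̂(H,G) = ∏_{i=1}^{ℓ} (|G : M_i| − 1). -/

import Mathlib

/-- The dual Euler totient of the Boolean interval `[H, G]` of rank `ℓ`,
computed from an order isomorphism `e` of the interval with the Boolean lattice
of all subsets of `Fin ℓ`: the atoms of the interval are `A i = e.symm {i}`, and
`φ̂(H,G) = Σ_{I ⊆ Fin ℓ} (−1)^{|I|} · |G : ⋁_{i∈I} A i|`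
(the join over the empty set being `H`). -/
noncomputable def dualEulerTotient {G : Type*} [Group G] (H : Subgroup G) {ℓ : ℕ}
    (e : Set.Ici H ≃o Finset (Fin ℓ)) : ℤ :=
  ∑ I : Finset (Fin ℓ),
    (-1 : ℤ) ^ I.card *
      (((I.sup fun i => ((e.symm {i}).1 : Subgroup G)) ⊔ H).index : ℤ)

open scoped Pointwise

/-- If `A * B` is the whole group, then the index of `A ⊓ B` is the product of the indices. -/
lemma Subgroup.index_inf_of_mul_eq_univ {G : Type*} [Group G] {A B : Subgroup G}
    (h : (A : Set G) * (B : Set G) = Set.univ) : (A ⊓ B).index = A.index * B.index := by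
  have htrans : MulAction.IsPretransitive A (G ⧸ B) := by
    refine (MulAction.isPretransitive_iff_base (((1 : G) : G ⧸ B))).2 fun x ↦ ?_
    induction x using QuotientGroup.induction_on with
    | H g =>
      obtain ⟨a, ha, b, hb, rfl⟩ : g ∈ (A : Set G) * (B : Set G) := h ▸ Set.mem_univ g
      refine ⟨⟨a, ha⟩, QuotientGroup.eq.2 ?_⟩
      simpa [Subgroup.smul_def] using hb
  have hstab : MulAction.stabilizer A (((1 : G) : G ⧸ B)) = B.subgroupOf A := by
    ext a
    rw [MulAction.mem_stabilizer_iff, Subgroup.mem_subgroupOf, ← inv_mem_iff (x := (a : G))]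
    refine QuotientGroup.eq.trans ?_
    simp
  have hrel : B.relIndex A = B.index := by
    rw [Subgroup.relIndex, ← hstab, MulAction.index_stabilizer_of_transitive, Subgroup.index]
  rw [← Subgroup.relIndex_mul_index inf_le_left, Subgroup.inf_relIndex_left, hrel, mul_comm]

/-- If two subgroups permute, then their product is their join. -/
lemma Subgroup.coe_sup_of_mul_comm {G : Type*} [Group G] {A B : Subgroup G}
    (h : (A : Set G) * (B : Set G) = (B : Set G) * (A : Set G)) :
    ((A ⊔ B : Subgroup G) : Set G) = (A : Set G) * (B : Set G) := by
  let N : Subgroup G :=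
    { carrier := (A : Set G) * (B : Set G)
      one_mem' := ⟨1, A.one_mem, 1, B.one_mem, one_mul 1⟩
      mul_mem' := fun {x y} hx hy ↦ by
        have hxy := Set.mul_mem_mul hx hy
        rwa [mul_assoc, ← mul_assoc (B : Set G), ← h, mul_assoc (A : Set G), coe_mul_coe,
          ← mul_assoc, coe_mul_coe] at hxy
      inv_mem' := fun {x} hx ↦ by
        have hx' := Set.inv_mem_inv.2 hx
        rwa [mul_inv_rev, inv_coe_set, inv_coe_set, ← h] at hx' }
  refine Set.Subset.antisymm ?_
    (Subgroup.mul_subset (le_sup_left : A ≤ A ⊔ B) (le_sup_right : B ≤ A ⊔ B))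
  have hN : A ⊔ B ≤ N := sup_le
    (fun a ha ↦ ⟨a, ha, 1, B.one_mem, mul_one a⟩) (fun b hb ↦ ⟨1, A.one_mem, b, hb, one_mul b⟩)
  exact hN

section BooleanInterval

variable {G : Type*} [Group G] {H : Subgroup G} {α : Type*} [DecidableEq α]
  (e : Set.Ici H ≃o Finset α)

lemma coe_symm_sup (I J : Finset α) :
    (e.symm (I ∪ J)).1 = (e.symm I).1 ⊔ (e.symm J).1 := by
  rw [← Finset.sup_eq_union, map_sup]
  rfl

lemma coe_symm_inf (I J : Finset α) :
    (e.symm (I ∩ J)).1 = (e.symm I).1 ⊓ (e.symm J).1 := by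
  rw [← Finset.inf_eq_inter, map_inf]
  rfl

lemma coe_symm_empty : (e.symm ∅).1 = H := by
  rw [← Finset.bot_eq_empty, map_bot]
  rfl

lemma sup_atoms_sup_bot (I : Finset α) :
    (I.sup fun i ↦ (e.symm {i}).1) ⊔ H = (e.symm I).1 := by
  induction I using Finset.induction_on with
  | empty => rw [Finset.sup_empty, bot_sup_eq, coe_symm_empty]
  | insert i I _ ih => rw [Finset.sup_insert, sup_assoc, ih, Finset.insert_eq, coe_symm_sup]

variable [Fintype α]

lemma coe_symm_univ : (e.symm Finset.univ).1 = ⊤ := by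
  rw [← Finset.top_eq_univ, map_top]
  rfl

lemma mul_eq_univ_of_union_eq_univ
    (hgc : ∀ I : Finset α,
      ((e.symm I).1 : Set G) * ((e.symm Iᶜ).1 : Set G) =
        ((e.symm Iᶜ).1 : Set G) * ((e.symm I).1 : Set G))
    {I J : Finset α} (hIJ : I ∪ J = Finset.univ) :
    ((e.symm I).1 : Set G) * ((e.symm J).1 : Set G) = Set.univ := by
  have hle : (e.symm Iᶜ).1 ≤ (e.symm J).1 := by
    refine e.symm.monotone fun i hi ↦ ?_
    exact (Finset.mem_union.1 (hIJ ▸ Finset.mem_univ i)).resolve_left (Finset.mem_compl.1 hi)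
  refine Set.univ_subset_iff.1 ((Set.univ_subset_iff.2 ?_).trans (Set.mul_subset_mul_left hle))
  rw [← Subgroup.coe_sup_of_mul_comm (hgc I), ← coe_symm_sup, Finset.union_compl,
    coe_symm_univ, Subgroup.coe_top]

lemma index_symm_compl
    (hgc : ∀ I : Finset α,
      ((e.symm I).1 : Set G) * ((e.symm Iᶜ).1 : Set G) =
        ((e.symm Iᶜ).1 : Set G) * ((e.symm I).1 : Set G))
    (S : Finset α) :
    (e.symm Sᶜ).1.index = ∏ i ∈ S, (e.symm {i}ᶜ).1.index := by
  induction S using Finset.induction_on with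
  | empty => rw [Finset.compl_empty, coe_symm_univ, Subgroup.index_top, Finset.prod_empty]
  | insert i S hi ih =>
    have hunion : ({i}ᶜ ∪ Sᶜ : Finset α) = Finset.univ := by
      rw [← Finset.compl_inter, Finset.singleton_inter_of_notMem hi, Finset.compl_empty]
    rw [Finset.prod_insert hi, ← ih, Finset.insert_eq, Finset.compl_union, coe_symm_inf,
      Subgroup.index_inf_of_mul_eq_univ (mul_eq_univ_of_union_eq_univ e hgc hunion)]

end BooleanInterval

/-- Let `G` be a finite group and `H ≤ G` a subgroup such that the
overgroup lattice `O_G(H)` is Boolean of rank `ℓ` with coatoms `M i = e.symm {i}ᶜ`,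
and suppose `O_G(H)` is group-complemented, i.e. `K·K^∁ = K^∁·K` (as subsets of `G`)
for every `K` in the interval. Then `φ̂(H,G) = ∏ᵢ (|G : M i| − 1)`. -/
theorem statement18 {G : Type*} [Group G] [Finite G] (H : Subgroup G) {ℓ : ℕ}
    (e : Set.Ici H ≃o Finset (Fin ℓ))
    (hgc : ∀ I : Finset (Fin ℓ),
      (((e.symm I).1 : Set G) * ((e.symm Iᶜ).1 : Set G)) =
        (((e.symm Iᶜ).1 : Set G) * ((e.symm I).1 : Set G))) :
    dualEulerTotient H e =
      ∏ i : Fin ℓ, ((((e.symm ({i}ᶜ : Finset (Fin ℓ))).1 : Subgroup G).index : ℤ) - 1) := by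
  simp only [dualEulerTotient, sup_atoms_sup_bot]
  rw [Finset.prod_sub, Finset.powerset_univ]
  refine Finset.sum_congr rfl fun I _ ↦ ?_
  rw [Finset.prod_const_one, mul_one, ← Finset.compl_eq_univ_sdiff, ← Nat.cast_prod,
    ← index_symm_compl e hgc, compl_compl]
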